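/- Let P be a white noise probability measure on 𝒮'(ℝ). Then for all multi-indices α, β ∈ 𝒥: ∫ H_α(ω) H_β(ω) dP(ω) = 0 whenever α ≠ β, and ∫ H_α(ω)² dP(ω) = α!. -/

import Mathlib

open MeasureTheory

noncomputable section

/-- The Schwartz space `𝒮(ℝ)` of rapidly decreasing smooth real functions. -/
abbrev SchwartzR := SchwartzMap ℝ ℝ

/-- The space of tempered distributions `𝒮'(ℝ)` with the weak-* topology. -/
abbrev TemperedDistR := WeakDual ℝ SchwartzR

/-- The Borel σ-algebra of the weak-* topology on `𝒮'(ℝ)`. -/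
instance : MeasurableSpace TemperedDistR := borel TemperedDistR

/-- The `n`-th probabilists' Hermite polynomial
`hₙ(x) = (−1)ⁿ e^{x²/2} (dⁿ/dxⁿ) e^{−x²/2}`. -/
def hermiteP (n : ℕ) (x : ℝ) : ℝ :=
  (-1 : ℝ)^n * Real.exp (x^2 / 2) * iteratedDeriv n (fun y => Real.exp (-(y^2) / 2)) x

/-- The `k`-th Hermite function (`k ≥ 1`):
`e_k(x) = π^{−1/4} ((k−1)!)^{−1/2} e^{−x²/2} h_{k−1}(√2 x)`. -/
def hermiteFun (k : ℕ) (x : ℝ) : ℝ :=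
  Real.pi ^ (-(1/4) : ℝ) * ((Nat.factorial (k - 1) : ℝ)) ^ (-(1/2) : ℝ) *
    Real.exp (-(x^2) / 2) * hermiteP (k - 1) (Real.sqrt 2 * x)

/-- The set `𝒥` of multi-indices: finitely supported functions from `{1,2,…}` (here indexed
by `ℕ`, index `j` standing for `j+1`) to the nonnegative integers. -/
abbrev MultiIndex := ℕ →₀ ℕ

/-- `α! = Π_j α_j!` for a multi-index `α`. -/
def mfact (α : MultiIndex) : ℝ :=
  α.prod fun _ n => (Nat.factorial n : ℝ)

/-- `H_α(ω) = Π_j h_{α_j}(⟨ω, e_j⟩)`, a finite product since `α` is finitely supported;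
here `e : ℕ → 𝒮(ℝ)` is a family with `e k` equal (as a function) to the `k`-th Hermite
function, and index `j : ℕ` of the finsupp stands for the integer `j + 1`. -/
def Hmulti (e : ℕ → SchwartzR) (α : MultiIndex) (ω : TemperedDistR) : ℝ :=
  α.prod fun j n => hermiteP n (ω (e (j + 1)))

open Polynomial ProbabilityTheory

theorem Polynomial.derivative_hermite_succ (n : ℕ) :
    derivative (hermite (n + 1)) = ((n + 1 : ℕ) : ℤ[X]) * hermite n := by
  induction n with
  | zero => simp
  | succ n ih =>
    have h := congrArg derivative ih
    rw [hermite_succ (n + 1), derivative_sub, derivative_mul, h, ih, derivative_mul,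
      derivative_natCast, derivative_X, hermite_succ n]
    push_cast
    ring

theorem hermiteP_eq_aeval_hermite (n : ℕ) (x : ℝ) : hermiteP n x = aeval x (hermite n) := by
  rw [hermite_eq_deriv_gaussian', hermiteP, iteratedDeriv_eq_iterate]
  simp only [neg_div]
  ring

theorem hermiteP_zero (x : ℝ) : hermiteP 0 x = 1 := by
  simp [hermiteP_eq_aeval_hermite]

theorem integrable_aeval_mul_gaussian (p : ℤ[X]) :
    Integrable fun x : ℝ => aeval x p * Real.exp (-(x ^ 2) / 2) := by
  induction p using Polynomial.induction_on' with
  | add p q hp hq =>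
    refine (hp.add hq).congr (.of_forall fun x => ?_)
    simp [add_mul]
  | monomial n a =>
    have h := (integrable_rpow_mul_exp_neg_mul_sq (b := 1 / 2) (by norm_num)
      (s := n) (by linarith [n.cast_nonneg (α := ℝ)])).const_mul (a : ℝ)
    refine h.congr (.of_forall fun x => ?_)
    simp only [Real.rpow_natCast, aeval_monomial, algebraMap_int_eq, eq_intCast]
    rw [mul_assoc, show -(1 / 2) * x ^ 2 = -x ^ 2 / 2 by ring]

theorem hasDerivAt_aeval_mul_gaussian (q : ℤ[X]) (x : ℝ) :
    HasDerivAt (fun x : ℝ => aeval x q * Real.exp (-(x ^ 2) / 2))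
      (aeval x (derivative q - X * q) * Real.exp (-(x ^ 2) / 2)) x := by
  have hg : HasDerivAt (fun x : ℝ => Real.exp (-(x ^ 2) / 2))
      (Real.exp (-(x ^ 2) / 2) * (-x)) x := by
    refine HasDerivAt.exp ?_
    convert! ((hasDerivAt_pow 2 x).neg).div_const 2 using 1
    simp only [Nat.cast_ofNat, Nat.add_one_sub_one, pow_one]
    ring
  convert! (q.hasDerivAt_aeval x).mul hg using 1
  simp only [map_sub, map_mul, aeval_X]
  ring

theorem integral_hermite_succ_mul_gaussian (n : ℕ) (p : ℤ[X]) :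
    ∫ x : ℝ, aeval x (hermite (n + 1) * p) * Real.exp (-(x ^ 2) / 2) =
      ∫ x : ℝ, aeval x (hermite n * derivative p) * Real.exp (-(x ^ 2) / 2) := by
  have h := integral_eq_zero_of_hasDerivAt_of_integrable
    (hasDerivAt_aeval_mul_gaussian (hermite n * p))
    (integrable_aeval_mul_gaussian _) (integrable_aeval_mul_gaussian _)
  rw [← sub_eq_zero, ← integral_sub (integrable_aeval_mul_gaussian _)
    (integrable_aeval_mul_gaussian _), ← neg_eq_zero, ← integral_neg, ← h]
  congr 1 with x
  rw [← sub_mul, ← neg_mul, ← map_sub, ← map_neg]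
  congr 2
  rw [hermite_succ, derivative_mul]
  ring

theorem integral_hermite_mul_hermite_mul_gaussian (m n : ℕ) :
    ∫ x : ℝ, aeval x (hermite m * hermite n) * Real.exp (-(x ^ 2) / 2) =
      if m = n then (n.factorial : ℝ) * √(2 * Real.pi) else 0 := by
  induction m generalizing n with
  | zero =>
    cases n with
    | zero =>
      have h := integral_gaussian (1 / 2)
      rw [div_div_eq_mul_div, div_one, mul_comm Real.pi] at h
      simp [← h, div_eq_inv_mul]
    | succ n =>
      rw [mul_comm, integral_hermite_succ_mul_gaussian]
      simp
  | succ m ih =>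
    rw [integral_hermite_succ_mul_gaussian]
    cases n with
    | zero => simp
    | succ n =>
      rw [derivative_hermite_succ, mul_left_comm]
      simp only [map_mul _ (Nat.cast _), map_natCast, mul_assoc, integral_const_mul]
      rw [ih, Nat.factorial_succ]
      simp [mul_assoc]

/-- The Hermite polynomials are orthogonal with respect to the standard Gaussian measure. -/
theorem integral_hermiteP_mul_hermiteP_gaussianReal (m n : ℕ) :
    ∫ x, hermiteP m x * hermiteP n x ∂(gaussianReal 0 1) =
      if m = n then (n.factorial : ℝ) else 0 := by
  have h : √(2 * Real.pi) ≠ 0 := by positivity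
  have h₂ : ∀ x, gaussianPDFReal 0 1 x • (hermiteP m x * hermiteP n x) =
      (√(2 * Real.pi))⁻¹ * (aeval x (hermite m * hermite n) * Real.exp (-(x ^ 2) / 2)) := by
    intro x
    simp only [gaussianPDFReal, hermiteP_eq_aeval_hermite, map_mul, smul_eq_mul, NNReal.coe_one,
      mul_one, sub_zero]
    ring
  simp only [integral_gaussianReal_eq_integral_smul one_ne_zero, h₂, integral_const_mul,
    integral_hermite_mul_hermite_mul_gaussian]
  split_ifs
  · field_simp
  · simp

theorem hermiteFun_succ_mul_hermiteFun_succ (j k : ℕ) (x : ℝ) :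
    hermiteFun (j + 1) x * hermiteFun (k + 1) x =
      Real.pi ^ (-(1/2) : ℝ) *
        ((j.factorial : ℝ) ^ (-(1/2) : ℝ) * (k.factorial : ℝ) ^ (-(1/2) : ℝ)) *
        (aeval (√2 * x) (hermite j * hermite k) * Real.exp (-((√2 * x) ^ 2) / 2)) := by
  have hπ : Real.pi ^ (-(1/2) : ℝ) = Real.pi ^ (-(1/4) : ℝ) * Real.pi ^ (-(1/4) : ℝ) := by
    rw [← Real.rpow_add Real.pi_pos]
    norm_num
  have hx : Real.exp (-((√2 * x) ^ 2) / 2) =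
      Real.exp (-(x ^ 2) / 2) * Real.exp (-(x ^ 2) / 2) := by
    rw [← Real.exp_add, mul_pow, Real.sq_sqrt zero_le_two]
    ring_nf
  simp only [hermiteFun, hπ, hx, hermiteP_eq_aeval_hermite, map_mul, Nat.add_sub_cancel]
  ring

theorem integrable_hermiteFun_succ_mul (j k : ℕ) :
    Integrable fun x => hermiteFun (j + 1) x * hermiteFun (k + 1) x := by
  simp only [hermiteFun_succ_mul_hermiteFun_succ]
  exact ((integrable_aeval_mul_gaussian (hermite j * hermite k)).comp_mul_left'
    (by positivity : √(2 : ℝ) ≠ 0)).const_mul _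

/-- The Hermite functions are orthonormal in `L²(ℝ)`. -/
theorem integral_hermiteFun_succ_mul (j k : ℕ) :
    ∫ x, hermiteFun (j + 1) x * hermiteFun (k + 1) x = if j = k then 1 else 0 := by
  simp only [hermiteFun_succ_mul_hermiteFun_succ]
  rw [integral_const_mul, Measure.integral_comp_mul_left
    (fun x : ℝ => aeval x (hermite j * hermite k) * Real.exp (-(x ^ 2) / 2)),
    integral_hermite_mul_hermite_mul_gaussian]
  split_ifs with h
  · subst h
    have hj : (0 : ℝ) < j.factorial := by positivity
    rw [← Real.rpow_add hj, Real.sqrt_mul zero_le_two, Real.rpow_neg Real.pi_pos.le,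
      ← Real.sqrt_eq_rpow, abs_of_pos (by positivity), smul_eq_mul]
    norm_num [Real.rpow_neg_one]
    field_simp
  · simp

instance : BorelSpace TemperedDistR := ⟨rfl⟩

theorem measurable_eval_temperedDist (φ : SchwartzR) :
    Measurable fun ω : TemperedDistR => ω φ :=
  (WeakDual.eval_continuous φ).measurable

/-- Under a white noise measure, the pairings with finitely many `L²`-orthonormal test functions
are independent standard Gaussian variables. -/
theorem map_eval_eq_pi_gaussianReal (P : Measure TemperedDistR) [IsProbabilityMeasure P]
    (hP : ∀ φ : SchwartzR,
      ∫ ω, Complex.exp (Complex.I * ((ω φ : ℝ) : ℂ)) ∂P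
        = Complex.exp (-(1/2) * ((∫ x, (φ x)^2 : ℝ) : ℂ)))
    {ι : Type*} [Fintype ι] [DecidableEq ι] (f : ι → SchwartzR)
    (hint : ∀ i j, Integrable fun x => f i x * f j x)
    (hf : ∀ i j, ∫ x, f i x * f j x = if i = j then 1 else 0) :
    P.map (fun ω i => ω (f i)) = Measure.pi fun _ => gaussianReal 0 1 := by
  have hm : Measurable fun (ω : TemperedDistR) i => ω (f i) :=
    measurable_pi_lambda _ fun i => measurable_eval_temperedDist (f i)
  have := Measure.isProbabilityMeasure_map (μ := P) hm.aemeasurable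
  refine charFun_eq_pi_iff.mp fun t => ?_
  have hnorm : ∫ x, ((∑ i, t i • f i : SchwartzR) x) ^ 2 = ∑ i, t i ^ 2 := by
    have hx : ∀ x, ((∑ i, t i • f i : SchwartzR) x) ^ 2 =
        ∑ i, ∑ j, t i * t j * (f i x * f j x) := by
      intro x
      rw [sum_apply, sq, Finset.sum_mul_sum]
      refine Finset.sum_congr rfl fun i _ => Finset.sum_congr rfl fun j _ => ?_
      simp only [smul_apply, smul_eq_mul]
      ring
    simp only [hx]
    rw [integral_finsetSum _ fun i _ => integrable_finsetSum _ fun j _ => (hint i j).const_mul _]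
    refine Finset.sum_congr rfl fun i _ => ?_
    rw [integral_finsetSum _ fun j _ => (hint i j).const_mul _]
    simp [integral_const_mul, hf, sq]
  have h := hP (∑ i, t i • f i)
  rw [hnorm] at h
  rw [charFun_apply, integral_map (by fun_prop) (by fun_prop),
    integral_map hm.aemeasurable (by fun_prop)]
  simp only [charFun_gaussianReal, ← Complex.exp_sum]
  convert! h using 1
  · congr 1 with ω
    simp [PiLp.inner_apply, mul_comm]
  · simp [Finset.mul_sum, div_eq_inv_mul]

theorem Hmulti_eq_prod (e : ℕ → SchwartzR) (α : MultiIndex) {s : Finset ℕ} (hs : α.support ⊆ s)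
    (ω : TemperedDistR) : Hmulti e α ω = ∏ j : s, hermiteP (α j) (ω (e (j + 1))) := by
  rw [Hmulti, Finsupp.prod_of_support_subset α hs _ fun _ _ => hermiteP_zero _,
    Finset.prod_coe_sort s fun j => hermiteP (α j) (ω (e (j + 1)))]

theorem measurable_hermiteP (n : ℕ) : Measurable (hermiteP n) := by
  have h : hermiteP n = fun x => aeval x (hermite n) := funext (hermiteP_eq_aeval_hermite n)
  rw [h]
  exact (hermite n).continuous_aeval.measurable

theorem integral_Hmulti_mul_Hmulti (P : Measure TemperedDistR) [IsProbabilityMeasure P]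
    (hP : ∀ φ : SchwartzR,
      ∫ ω, Complex.exp (Complex.I * ((ω φ : ℝ) : ℂ)) ∂P
        = Complex.exp (-(1/2) * ((∫ x, (φ x)^2 : ℝ) : ℂ)))
    (e : ℕ → SchwartzR) (he : ∀ (k : ℕ) (x : ℝ), e k x = hermiteFun k x)
    (α β : MultiIndex) :
    ∫ ω, Hmulti e α ω * Hmulti e β ω ∂P =
      ∏ j ∈ α.support ∪ β.support, if α j = β j then ((β j).factorial : ℝ) else 0 := by
  set s := α.support ∪ β.support
  have hlaw := map_eval_eq_pi_gaussianReal P hP (fun j : s => e (j + 1))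
    (fun i j => by simpa only [he] using integrable_hermiteFun_succ_mul i j)
    (fun i j => by simp only [he, integral_hermiteFun_succ_mul, Subtype.ext_iff])
  have hm : Measurable fun (ω : TemperedDistR) (j : s) => ω (e (j + 1)) :=
    measurable_pi_lambda _ fun j => measurable_eval_temperedDist _
  have hF : Measurable fun x : s → ℝ => ∏ j : s, (hermiteP (α j) (x j) * hermiteP (β j) (x j)) :=
    Finset.measurable_fun_prod _ fun j _ =>
      ((measurable_hermiteP _).comp (measurable_pi_apply j)).mul
        ((measurable_hermiteP _).comp (measurable_pi_apply j))
  simp only [Hmulti_eq_prod e α (s := s) Finset.subset_union_left,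
    Hmulti_eq_prod e β (s := s) Finset.subset_union_right, ← Finset.prod_mul_distrib]
  rw [← integral_map (f := fun x : s → ℝ => ∏ j : s, (hermiteP (α j) (x j) * hermiteP (β j) (x j)))
    hm.aemeasurable hF.aestronglyMeasurable, hlaw, integral_fintype_prod_eq_prod
    (fun (j : s) (x : ℝ) => hermiteP (α j) x * hermiteP (β j) x)]
  simp only [integral_hermiteP_mul_hermiteP_gaussianReal]
  exact Finset.prod_coe_sort s fun j => if α j = β j then ((β j).factorial : ℝ) else 0

/-- If `P` is a white noise probability measure on `𝒮'(ℝ)`, then for all multi-indices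
`α, β ∈ 𝒥`: `∫ H_α H_β dP = 0` whenever `α ≠ β`, and `∫ H_α² dP = α!`. -/
theorem Hmulti_orthogonality
    (P : Measure TemperedDistR) [IsProbabilityMeasure P]
    (hP : ∀ φ : SchwartzR,
      ∫ ω, Complex.exp (Complex.I * ((ω φ : ℝ) : ℂ)) ∂P
        = Complex.exp (-(1/2) * ((∫ x, (φ x)^2 : ℝ) : ℂ)))
    (e : ℕ → SchwartzR) (he : ∀ (k : ℕ) (x : ℝ), e k x = hermiteFun k x)
    (α β : MultiIndex) :
    (α ≠ β → ∫ ω, Hmulti e α ω * Hmulti e β ω ∂P = 0) ∧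
    (∫ ω, (Hmulti e α ω)^2 ∂P = mfact α) := by
  have h := integral_Hmulti_mul_Hmulti P hP e he α
  refine ⟨fun hαβ => ?_, ?_⟩
  · obtain ⟨j, hj⟩ := Finsupp.ne_iff.mp hαβ
    rw [h β]
    refine Finset.prod_eq_zero (i := j) ?_ (if_neg hj)
    by_contra hmem
    simp only [Finset.mem_union, Finsupp.mem_support_iff, not_or, not_not] at hmem
    exact hj (hmem.1.trans hmem.2.symm)
  · simp only [sq, h α, Finset.union_self, if_true, mfact, Finsupp.prod]


end
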